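/- Let A be a d×d matrix over C(z), q ∈ C[z] irreducible, n := -ord_q(A), and r := rank of the leading matrix lc_q(A) over C[z]/⟨q⟩. Then there exists a unimodular polynomial matrix S (with determinant a nonzero constant) such that φ(S⁻¹)·A·S has the block column form (q^{-n}·A₁ , q^{-(n-1)}·A₂), where A₁, A₂ have entries in the local ring O_q, A₁ is d×r of rank r, and A₂ is d×(d−r). -/

import Mathlib

open Polynomial Matrix

noncomputable section
open scoped Classical

variable {K : Type*} [Field K]

/-- The order (q-adic valuation) of a rational function at an irreducible polynomial `q`. -/
def ordAt (q : Polynomial K) (f : RatFunc K) : WithTop ℤ :=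
  if f = 0 then ⊤ else ((multiplicity q f.num : ℤ) - (multiplicity q f.denom : ℤ) : ℤ)

/-- The order at `q` of a matrix: the minimum of the orders of its entries. -/
def matOrdAt {d : ℕ} (q : Polynomial K) (A : Matrix (Fin d) (Fin d) (RatFunc K)) : WithTop ℤ :=
  (Finset.univ : Finset (Fin d × Fin d)).inf fun ij => ordAt q (A ij.1 ij.2)

/-- The value of a rational function at an irreducible `q` (reduction modulo `q`),
junk value `0` if the function has a pole at `q`. -/
def piAt (q : Polynomial K) (hq : Irreducible q) (f : RatFunc K) : AdjoinRoot q :=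
  letI : Fact (Irreducible q) := ⟨hq⟩
  AdjoinRoot.mk q f.num * (AdjoinRoot.mk q f.denom)⁻¹

/-- Entrywise reduction of a matrix modulo `q`. -/
def matPiAt {d : ℕ} (q : Polynomial K) (hq : Irreducible q)
    (A : Matrix (Fin d) (Fin d) (RatFunc K)) : Matrix (Fin d) (Fin d) (AdjoinRoot q) :=
  Matrix.of fun i j => piAt q hq (A i j)

/-- The leading matrix of `A` at `q`: the value at `q` of `q^n • A` where `n = -ord_q(A)`. -/
def lcAt {d : ℕ} (q : Polynomial K) (hq : Irreducible q) (n : ℤ)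
    (A : Matrix (Fin d) (Fin d) (RatFunc K)) : Matrix (Fin d) (Fin d) (AdjoinRoot q) :=
  matPiAt q hq (Matrix.of fun i j => algebraMap (Polynomial K) (RatFunc K) q ^ n * A i j)

/-- `φ^j` applied to a polynomial: `q(z) ↦ q(z + j)`. -/
def shiftPoly (j : ℕ) (q : Polynomial K) : Polynomial K :=
  q.comp (X + C (j : K))

/-- A common denominator of the entries of a matrix over `C(z)`. -/
def denMat {d : ℕ} (A : Matrix (Fin d) (Fin d) (RatFunc K)) : Polynomial K :=
  ∏ i, ∏ j, (A i j).denom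

/-- `q` is a φ-minimal pole of `A`: `q` divides the denominator of `A`, but no
forward shift `φ^j(q)` (`j ≥ 1`) does. -/
def PhiMinimalPole {d : ℕ} (q : Polynomial K) (A : Matrix (Fin d) (Fin d) (RatFunc K)) : Prop :=
  q ∣ denMat A ∧ ∀ j : ℕ, 1 ≤ j → ¬ shiftPoly j q ∣ denMat A

/-- The φ-dispersion of `A` at `q`: the largest `ℓ ≥ 1` with `φ^ℓ(q) ∣ num(det A)` (0 if none). -/
def phiDispersion {d : ℕ} (q : Polynomial K) (A : Matrix (Fin d) (Fin d) (RatFunc K)) : ℕ :=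
  sSup {ℓ : ℕ | 0 < ℓ ∧ shiftPoly ℓ q ∣ (Matrix.det A).num}

namespace ColumnReduction

section Lift

variable {R F : Type*} [CommRing R] [Field F]

lemma exists_lift_transvection_prod {n : Type*} [Fintype n] [DecidableEq n] (f : R →+* F)
    (hf : Function.Surjective f) (L : List (TransvectionStruct n F)) :
    ∃ P : Matrix n n R, P.det = 1 ∧ P.map f = (L.map TransvectionStruct.toMatrix).prod := by
  induction L with
  | nil => exact ⟨1, by simp, by simp⟩
  | cons t L ih =>
    obtain ⟨P, hP, hPL⟩ := ih
    obtain ⟨c, hc⟩ := hf t.c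
    refine ⟨transvection t.i t.j c * P, ?_, ?_⟩
    · rw [det_mul, hP, det_transvection_of_ne _ _ t.hij, one_mul]
    · rw [List.map_cons, List.prod_cons, ← hPL, Matrix.map_mul]
      congr 1
      simp [transvection, TransvectionStruct.toMatrix, Matrix.map_add, Matrix.map_single, hc]

lemma exists_perm_ne_zero_iff_lt_rank {d : ℕ} (D : Fin d → F) :
    ∃ σ : Equiv.Perm (Fin d), ∀ j, D (σ j) ≠ 0 ↔ (j : ℕ) < (diagonal D).rank := by
  have hle : (diagonal D).rank ≤ d := by simpa using rank_le_width (diagonal D)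
  have hcard : Fintype.card {j : Fin d // (j : ℕ) < (diagonal D).rank} =
      Fintype.card {j : Fin d // D j ≠ 0} := by
    rw [← rank_diagonal D, Fintype.card_subtype, Fin.card_filter_val_lt, min_eq_right hle]
  let e := Fintype.equivOfCardEq hcard
  refine ⟨e.extendSubtype, fun j => ⟨fun h => ?_, fun h => e.extendSubtype_mem j h⟩⟩
  by_contra hj
  exact e.extendSubtype_not_mem j hj h

/-- A matrix over a ring with a residue field can be brought, by multiplication with matrices of
unit determinant, to a form whose reduction has an invertible leading block and vanishing
remaining columns. -/
lemma exists_reduction {d r : ℕ} (f : R →+* F) (hf : Function.Surjective f)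
    (N : Matrix (Fin d) (Fin d) R) (hr : (N.map f).rank = r) (hrd : r ≤ d) :
    ∃ T S : Matrix (Fin d) (Fin d) R, IsUnit T.det ∧ IsUnit S.det ∧
      (∀ i j : Fin d, r ≤ (j : ℕ) → f ((T * N * S) i j) = 0) ∧
      f ((T * N * S).submatrix (Fin.castLE hrd) (Fin.castLE hrd)).det ≠ 0 := by
  obtain ⟨L, L', D, hD⟩ := Pivot.exists_list_transvec_mul_mul_list_transvec_eq_diagonal (N.map f)
  obtain ⟨P, hP, hPL⟩ := exists_lift_transvection_prod f hf L
  obtain ⟨Q, hQ, hQL⟩ := exists_lift_transvection_prod f hf L'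
  have hrD : (diagonal D).rank = r := by
    rw [← hD, rank_mul_eq_left_of_isUnit_det _ _ (by simp),
      rank_mul_eq_right_of_isUnit_det _ _ (by simp), hr]
  obtain ⟨σ, hσ⟩ := exists_perm_ne_zero_iff_lt_rank D
  rw [hrD] at hσ
  have hW : (P.submatrix σ id * N * Q.submatrix id σ).map f = diagonal (D ∘ σ) := by
    have : P.submatrix σ id * N * Q.submatrix id σ = (P * N * Q).submatrix σ σ := by
      ext i j
      simp [Matrix.mul_apply]
    rw [this, ← submatrix_map, Matrix.map_mul, Matrix.map_mul, hPL, hQL, hD,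
      submatrix_diagonal_equiv]
  have hW' (i j) := congrFun (congrFun hW i) j
  simp only [map_apply] at hW'
  refine ⟨P.submatrix σ id, Q.submatrix id σ, ?_, ?_, fun i j hj => ?_, ?_⟩
  · rw [det_permute, hP, mul_one]
    exact (Equiv.Perm.sign σ).isUnit.map (Int.castRingHom R)
  · rw [det_permute', hQ, mul_one]
    exact (Equiv.Perm.sign σ).isUnit.map (Int.castRingHom R)
  · rw [hW', diagonal_apply]
    split_ifs with h
    · subst h
      by_contra h0
      exact absurd ((hσ i).1 h0) (by omega)
    · rfl
  · rw [RingHom.map_det, RingHom.mapMatrix_apply, ← submatrix_map, hW,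
      submatrix_diagonal _ _ (Fin.castLE_injective hrd), det_diagonal]
    exact Finset.prod_ne_zero_iff.2 fun j _ => (hσ _).2 j.isLt

end Lift

section Order

variable {K : Type*} [Field K] {q : K[X]}

local notation "ι" => algebraMap (Polynomial K) (RatFunc K)

lemma ordAt_div (hq : Irreducible q) {a b : K[X]} (ha : a ≠ 0) (hb : b ≠ 0) :
    ordAt q (ι a / ι b) = ((multiplicity q a : ℤ) - (multiplicity q b : ℤ) : ℤ) := by
  have hf : ι a / ι b ≠ 0 :=
    div_ne_zero (RatFunc.algebraMap_ne_zero ha) (RatFunc.algebraMap_ne_zero hb)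
  set f := ι a / ι b with hfdef
  have hfin {p : K[X]} (hp : p ≠ 0) : FiniteMultiplicity q p :=
    FiniteMultiplicity.of_not_isUnit hq.not_isUnit hp
  have hnum : f.num ≠ 0 := RatFunc.num_ne_zero hf
  have hden : f.denom ≠ 0 := RatFunc.denom_ne_zero f
  have hmul : f.num * b = a * f.denom := by
    apply RatFunc.algebraMap_injective K
    rw [map_mul, map_mul, ← div_eq_div_iff (RatFunc.algebraMap_ne_zero hden)
      (RatFunc.algebraMap_ne_zero hb), RatFunc.num_div_denom]
  have h := congrArg (multiplicity q) hmul
  rw [multiplicity_mul hq.prime (hfin (mul_ne_zero hnum hb)),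
    multiplicity_mul hq.prime (hfin (mul_ne_zero ha hden))] at h
  rw [ordAt, if_neg hf]
  congr 1
  omega

lemma ordAt_div_nonneg (hq : Irreducible q) (a : K[X]) {b : K[X]} (hb : ¬ q ∣ b) :
    0 ≤ ordAt q (ι a / ι b) := by
  by_cases ha : a = 0
  · simp [ha, ordAt]
  · have hb0 : b ≠ 0 := fun h => hb (h ▸ dvd_zero q)
    rw [ordAt_div hq ha hb0, multiplicity_eq_zero.2 hb]
    exact WithTop.coe_le_coe.2 (by simp)

lemma not_dvd_denom_of_ordAt_nonneg {f : RatFunc K} (hq : Irreducible q) (hf : 0 ≤ ordAt q f) :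
    ¬ q ∣ f.denom := by
  intro hd
  by_cases hf0 : f = 0
  · subst hf0
    exact hq.not_isUnit (isUnit_of_dvd_one (by simpa using hd))
  have hn : ¬ q ∣ f.num := fun hn =>
    hq.not_isUnit ((RatFunc.isCoprime_num_denom f).isUnit_of_dvd' hn hd)
  have hpos := multiplicity_ne_zero.2 hd
  rw [ordAt, if_neg hf0, multiplicity_eq_zero.2 hn] at hf
  have : (0 : ℤ) ≤ ((0 : ℕ) : ℤ) - multiplicity q f.denom := WithTop.coe_le_coe.1 hf
  omega

lemma ordAt_zpow_mul_nonneg (hq : Irreducible q) {n : ℤ} {f : RatFunc K}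
    (hf : ((-n : ℤ) : WithTop ℤ) ≤ ordAt q f) : 0 ≤ ordAt q (ι q ^ n * f) := by
  by_cases hf0 : f = 0
  · simp [hf0, ordAt]
  have hnum : f.num ≠ 0 := RatFunc.num_ne_zero hf0
  have hden : f.denom ≠ 0 := RatFunc.denom_ne_zero f
  have hfin {p : K[X]} (hp : p ≠ 0) : FiniteMultiplicity q p :=
    FiniteMultiplicity.of_not_isUnit hq.not_isUnit hp
  rw [ordAt, if_neg hf0] at hf
  have hf' := WithTop.coe_le_coe.1 hf
  obtain ⟨m, rfl | rfl⟩ := n.eq_nat_or_neg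
  · have h : ι q ^ (m : ℤ) * f = ι (q ^ m * f.num) / ι f.denom := by
      rw [map_mul, mul_div_assoc, RatFunc.num_div_denom, map_pow, zpow_natCast]
    have hne := mul_ne_zero (pow_ne_zero m hq.ne_zero) hnum
    rw [h, ordAt_div hq hne hden, multiplicity_mul hq.prime (hfin hne),
      multiplicity_pow_self_of_prime hq.prime]
    apply WithTop.coe_le_coe.2
    push_cast
    omega
  · have h : ι q ^ (-(m : ℤ)) * f = ι f.num / ι (q ^ m * f.denom) := by
      conv_lhs => rw [← RatFunc.num_div_denom f]
      rw [map_mul, map_pow, _root_.zpow_neg, zpow_natCast, div_mul_eq_div_div_swap]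
      ring
    have hne := mul_ne_zero (pow_ne_zero m hq.ne_zero) hden
    rw [h, ordAt_div hq hnum hne, multiplicity_mul hq.prime (hfin hne),
      multiplicity_pow_self_of_prime hq.prime]
    apply WithTop.coe_le_coe.2
    push_cast
    omega

lemma piAt_mul_mk (hq : Irreducible q) {f : RatFunc K} {a b : K[X]} (hf : ¬ q ∣ f.denom)
    (hab : ι b * f = ι a) : AdjoinRoot.mk q b * piAt q hq f = AdjoinRoot.mk q a := by
  have : Fact (Irreducible q) := ⟨hq⟩
  have hden : AdjoinRoot.mk q f.denom ≠ 0 := fun h => hf (AdjoinRoot.mk_eq_zero.1 h)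
  have hmul : b * f.num = a * f.denom := by
    apply RatFunc.algebraMap_injective K
    rw [map_mul, map_mul, ← hab, mul_assoc]
    congr 1
    rw [← div_eq_iff (RatFunc.algebraMap_ne_zero (RatFunc.denom_ne_zero f)),
      RatFunc.num_div_denom]
  rw [piAt, ← mul_assoc, ← map_mul, hmul, map_mul, mul_assoc, mul_inv_cancel₀ hden, mul_one]

/-- A matrix of rational functions without pole at `q` has a common denominator prime to `q`. -/
lemma exists_common_denom (hq : Irreducible q) {m n : Type*} [Fintype m] [Fintype n]
    (B : Matrix m n (RatFunc K)) (hB : ∀ i j, ¬ q ∣ (B i j).denom) :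
    ∃ (b : K[X]) (N : Matrix m n K[X]), ¬ q ∣ b ∧ ι b • B = N.map ι := by
  let b : K[X] := ∏ i, ∏ j, (B i j).denom
  have hdvd (i j) : (B i j).denom ∣ b :=
    (Finset.dvd_prod_of_mem (fun j => (B i j).denom) (Finset.mem_univ j)).trans
      (Finset.dvd_prod_of_mem (fun i => ∏ j, (B i j).denom) (Finset.mem_univ i))
  choose c hc using hdvd
  refine ⟨b, Matrix.of fun i j => c i j * (B i j).num, fun h => ?_, ?_⟩
  · obtain ⟨i, -, hi⟩ := hq.prime.exists_mem_finset_dvd h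
    obtain ⟨j, -, hj⟩ := hq.prime.exists_mem_finset_dvd hi
    exact hB i j hj
  · ext i j
    have hne := RatFunc.algebraMap_ne_zero (RatFunc.denom_ne_zero (B i j))
    have hbij : ι (B i j).denom * B i j = ι (B i j).num := by
      rw [mul_comm, ← eq_div_iff hne, RatFunc.num_div_denom]
    simp only [Matrix.smul_apply, smul_eq_mul, map_apply, of_apply, map_mul]
    rw [hc i j, map_mul, mul_right_comm, hbij, mul_comm]

end Order

/-- A matrix whose leading square block is nonsingular has full
column rank. -/
lemma rank_eq_of_det_castLE_ne_zero {F : Type*} [Field F] {d r : ℕ} (hrd : r ≤ d)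
    (M : Matrix (Fin d) (Fin r) F) (hM : (M.submatrix (Fin.castLE hrd) id).det ≠ 0) :
    M.rank = r := by
  apply le_antisymm (by simpa using rank_le_width M)
  calc r = (M.submatrix (Fin.castLE hrd) id).rank := by
        rw [rank_of_isUnit _ ((isUnit_iff_isUnit_det _).2 hM.isUnit), Fintype.card_fin]
    _ ≤ M.rank := rank_submatrix_le M _ _

end ColumnReduction

open ColumnReduction in
/-- column reduction at `q` (Lemma `smithnf`). -/
theorem stmt2 {K : Type*} [Field K] {d : ℕ}
    (phi : RatFunc K ≃+* RatFunc K)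
    (hphi : ∀ p : Polynomial K, phi (algebraMap (Polynomial K) (RatFunc K) p)
        = algebraMap (Polynomial K) (RatFunc K) (p.comp (X + C 1)))
    (q : Polynomial K) (hq : Irreducible q)
    (A : Matrix (Fin d) (Fin d) (RatFunc K))
    (n : ℤ) (hn : matOrdAt q A = (-n : ℤ)) :
    let r := (lcAt q hq n A).rank
    ∃ (Sp : Matrix (Fin d) (Fin d) (Polynomial K))
      (A₁ : Matrix (Fin d) (Fin r) (RatFunc K))
      (A₂ : Matrix (Fin d) (Fin (d - r)) (RatFunc K)),
      IsUnit Sp.det ∧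
      (∀ i j, 0 ≤ ordAt q (A₁ i j)) ∧ (∀ i j, 0 ≤ ordAt q (A₂ i j)) ∧
      A₁.rank = r ∧
      ((Sp.map (algebraMap (Polynomial K) (RatFunc K)))⁻¹.map ⇑phi) * A
          * (Sp.map (algebraMap (Polynomial K) (RatFunc K)))
        = Matrix.of fun i (j : Fin d) =>
            if hj : (j : ℕ) < r then
              algebraMap (Polynomial K) (RatFunc K) q ^ (-n) * A₁ i ⟨j, hj⟩
            else
              algebraMap (Polynomial K) (RatFunc K) q ^ (-(n - 1))
                * A₂ i ⟨(j : ℕ) - r, by have := j.isLt; omega⟩ := by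
  intro r
  have : Fact (Irreducible q) := ⟨hq⟩
  let ι := algebraMap (Polynomial K) (RatFunc K)
  have hιq : ι q ≠ 0 := RatFunc.algebraMap_ne_zero hq.ne_zero
  have hB (i j) : ¬ q ∣ (ι q ^ n * A i j).denom := by
    apply not_dvd_denom_of_ordAt_nonneg hq
    apply ordAt_zpow_mul_nonneg hq
    rw [← hn]
    exact Finset.inf_le (f := fun ij : Fin d × Fin d => ordAt q (A ij.1 ij.2))
      (Finset.mem_univ (i, j))
  obtain ⟨b, N, hb, hbN⟩ :=
    exists_common_denom hq (Matrix.of fun i j => ι q ^ n * A i j) hB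
  have hb0 : b ≠ 0 := fun h => hb (h ▸ dvd_zero q)
  have hιb : ι b ≠ 0 := RatFunc.algebraMap_ne_zero hb0
  have hA : A = (ι q ^ (-n) * (ι b)⁻¹) • N.map ι := by
    rw [← hbN]
    ext i j
    simp only [Matrix.smul_apply, of_apply, smul_eq_mul]
    change _ = ι q ^ (-n) * (ι b)⁻¹ * (ι b * (ι q ^ n * A i j))
    rw [_root_.zpow_neg]
    field_simp
  have hlc : AdjoinRoot.mk q b • lcAt q hq n A = N.map (AdjoinRoot.mk q) := by
    ext i j
    exact piAt_mul_mk hq (hB i j) (congrFun (congrFun hbN i) j)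
  have hr : (N.map (AdjoinRoot.mk q)).rank = r := by
    rw [← hlc]
    exact rank_smul_of_mem_nonZeroDivisors _ (mem_nonZeroDivisors_of_ne_zero
      fun h => hb (AdjoinRoot.mk_eq_zero.1 h))
  have hrd : r ≤ d := by simpa using rank_le_width (lcAt q hq n A)
  obtain ⟨T, S, hT, hS, hcol, hdet⟩ :=
    exists_reduction (AdjoinRoot.mk q) AdjoinRoot.mk_surjective N hr hrd
  set W := T * N * S with hW
  let φ : K[X] →+* K[X] := compRingHom (X + C 1)
  let V := S⁻¹.map φ * T⁻¹
  have hVW : S⁻¹.map φ * N * S = V * W := by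
    simp only [V, hW, Matrix.mul_assoc]
    rw [nonsing_inv_mul_cancel_left _ _ hT]
  have hV : IsUnit V.det := by
    have h : (S⁻¹.map φ).det = φ S⁻¹.det := (RingHom.map_det φ S⁻¹).symm
    rw [det_mul, h]
    exact ((isUnit_nonsing_inv_det _ hS).map φ).mul (isUnit_nonsing_inv_det _ hT)
  have hSinv : ((S.map ι)⁻¹).map phi = (S⁻¹.map φ).map ι := by
    have h : (S.map ι)⁻¹ = S⁻¹.map ι := by
      apply inv_eq_right_inv
      rw [← Matrix.map_mul, mul_nonsing_inv _ hS, Matrix.map_one _ (map_zero _) (map_one _)]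
    rw [h]
    ext1 i j
    exact hphi _
  have hmain : ((S.map ι)⁻¹).map phi * A * S.map ι =
      (ι q ^ (-n) * (ι b)⁻¹) • (V * W).map ι := by
    rw [hSinv, hA, Matrix.mul_smul, Matrix.smul_mul, ← Matrix.map_mul, ← Matrix.map_mul, hVW]
  have hdvd (i j : Fin d) (hj : r ≤ (j : ℕ)) : q ∣ (V * W) i j := by
    rw [Matrix.mul_apply]
    exact Finset.dvd_sum fun k _ =>
      Dvd.dvd.mul_left (AdjoinRoot.mk_eq_zero.1 (hcol k j hj)) _
  choose! Q hQ using hdvd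
  refine ⟨S, Matrix.of fun i j => ι ((V * W) i (Fin.castLE hrd j)) / ι b,
    Matrix.of fun i j => ι (Q i ⟨r + j, by omega⟩) / ι b, hS,
    fun i j => ordAt_div_nonneg hq _ hb, fun i j => ordAt_div_nonneg hq _ hb, ?_, ?_⟩
  · have h : (Matrix.of fun i j => ι ((V * W) i (Fin.castLE hrd j)) / ι b) =
        (ι b)⁻¹ • (V.map ι * (W.map ι).submatrix id (Fin.castLE hrd)) := by
      ext i j
      simp [Matrix.mul_apply, div_eq_inv_mul]
    have hVι : IsUnit (V.map ι).det := by
      rw [show (V.map ι).det = ι V.det from (RingHom.map_det ι V).symm]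
      exact hV.map ι
    rw [h, rank_smul_of_mem_nonZeroDivisors _
      (mem_nonZeroDivisors_of_ne_zero (inv_ne_zero hιb)), rank_mul_eq_right_of_isUnit_det _ _ hVι]
    apply rank_eq_of_det_castLE_ne_zero hrd
    have h' : ((W.map ι).submatrix id (Fin.castLE hrd)).submatrix (Fin.castLE hrd) id =
        ι.mapMatrix (W.submatrix (Fin.castLE hrd) (Fin.castLE hrd)) := rfl
    rw [h', ← RingHom.map_det]
    exact RatFunc.algebraMap_ne_zero fun h0 => hdet (by rw [h0, map_zero])
  · change ((S.map ι)⁻¹).map phi * A * S.map ι = _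
    rw [hmain]
    ext i j
    simp only [Matrix.smul_apply, map_apply, smul_eq_mul, of_apply]
    split_ifs with hj
    · rw [div_eq_inv_mul, mul_assoc]
      rfl
    · have hj' : r ≤ (j : ℕ) := not_lt.1 hj
      have hidx : (⟨r + ((j : ℕ) - r), by omega⟩ : Fin d) = j := by
        ext
        simp only
        omega
      rw [hidx, hQ i j hj', map_mul, neg_sub, sub_eq_neg_add, zpow_add₀ hιq, zpow_one]
      ring

end
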